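/- Let n ≥ 3 and let g(x', x_n) = c(x', x_n)·blockdiag(ĝ(x'), 1) on ℝ^n as in the setup. Let u ∈ C²(ℝ^{n−1}) and set f(x', x_n) := x_n − u(x'). Then at every point x = (x', x_n) ∈ ℝ^n: c(x)² |∇_g f(x)|²_g Δ_g f(x) = (1 + |∇_ĝ u(x')|²_ĝ)·(−Δ_ĝ u(x') + ((2−n)/(2c(x))) Σ_{m,r=1}^{n−1} ĝ^{mr}(x') ∂_{x_r}c(x) ∂_{x_m}u(x') − ((2−n)/(2c(x))) ∂_{x_n}c(x)). -/

import Mathlib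

noncomputable section

open scoped BigOperators

/-- Partial derivative `∂_i f` at `x`. -/
def pd {k : ℕ} {E : Type*} [NormedAddCommGroup E] [NormedSpace ℝ E]
    (i : Fin k) (f : (Fin k → ℝ) → E) (x : Fin k → ℝ) : E :=
  fderiv ℝ f x (Pi.single i 1)

/-- Christoffel symbols `Γ(h)^m_{ij} = ½ h^{ml}(∂_i h_{jl} + ∂_j h_{il} − ∂_l h_{ij})`. -/
def christoffel {k : ℕ} (h : (Fin k → ℝ) → Matrix (Fin k) (Fin k) ℝ)
    (m i j : Fin k) (x : Fin k → ℝ) : ℝ :=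
  (1 / 2) * ∑ l : Fin k, (h x)⁻¹ m l *
    (pd i (fun y => h y j l) x + pd j (fun y => h y i l) x - pd l (fun y => h y i j) x)

/-- Laplace–Beltrami operator `Δ_h f = h^{ij}(∂²_{ij} f − Γ(h)^m_{ij} ∂_m f)`. -/
def laplaceB {k : ℕ} (h : (Fin k → ℝ) → Matrix (Fin k) (Fin k) ℝ)
    (f : (Fin k → ℝ) → ℝ) (x : Fin k → ℝ) : ℝ :=
  ∑ i : Fin k, ∑ j : Fin k, (h x)⁻¹ i j *
    (pd i (pd j f) x - ∑ l : Fin k, christoffel h l i j x * pd l f x)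

/-- Hessian `(∇²_h f)_{ij} = ∂²_{ij} f − Γ(h)^m_{ij} ∂_m f`. -/
def hessian {k : ℕ} (h : (Fin k → ℝ) → Matrix (Fin k) (Fin k) ℝ)
    (f : (Fin k → ℝ) → ℝ) (i j : Fin k) (x : Fin k → ℝ) : ℝ :=
  pd i (pd j f) x - ∑ l : Fin k, christoffel h l i j x * pd l f x

/-- Gradient components `(∇_h f)^i = h^{ij} ∂_j f`. -/
def gradC {k : ℕ} (h : (Fin k → ℝ) → Matrix (Fin k) (Fin k) ℝ)
    (f : (Fin k → ℝ) → ℝ) (i : Fin k) (x : Fin k → ℝ) : ℝ :=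
  ∑ j : Fin k, (h x)⁻¹ i j * pd j f x

/-- Squared gradient norm `|∇_h f|²_h = h^{ij} ∂_i f ∂_j f`. -/
def gradSq {k : ℕ} (h : (Fin k → ℝ) → Matrix (Fin k) (Fin k) ℝ)
    (f : (Fin k → ℝ) → ℝ) (x : Fin k → ℝ) : ℝ :=
  ∑ i : Fin k, ∑ j : Fin k, (h x)⁻¹ i j * pd i f x * pd j f x

/-- Divergence `div_h a = Σ_i (∂_i a^i + Σ_j a^j Γ(h)^i_{ij})`. -/
def divg {k : ℕ} (h : (Fin k → ℝ) → Matrix (Fin k) (Fin k) ℝ)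
    (a : Fin k → (Fin k → ℝ) → ℝ) (x : Fin k → ℝ) : ℝ :=
  ∑ i : Fin k, (pd i (a i) x + ∑ j : Fin k, a j x * christoffel h i i j x)

/-- The projection `x ↦ x'` onto the first `m` coordinates. -/
def proj {m : ℕ} (x : Fin (m + 1) → ℝ) : Fin m → ℝ := x ∘ Fin.castSucc

/-- The metric `g(x', x_n) = c(x', x_n) · blockdiag(ĝ(x'), 1)` on `ℝ^{m+1}`. -/
def gMet {m : ℕ} (c : (Fin (m + 1) → ℝ) → ℝ)
    (ghat : (Fin m → ℝ) → Matrix (Fin m) (Fin m) ℝ)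
    (x : Fin (m + 1) → ℝ) : Matrix (Fin (m + 1)) (Fin (m + 1)) ℝ :=
  Matrix.of fun i j =>
    c x * (if hi : (i : ℕ) < m then
             (if hj : (j : ℕ) < m then ghat (proj x) ⟨i, hi⟩ ⟨j, hj⟩ else 0)
           else (if (j : ℕ) < m then 0 else 1))

/-- A function `u` on `ℝ^m`, regarded as a function on `ℝ^{m+1}` independent of the last
coordinate. -/
def ext {m : ℕ} (u : (Fin m → ℝ) → ℝ) (x : Fin (m + 1) → ℝ) : ℝ := u (proj x)

section helpers

variable {m : ℕ}

def projL (m : ℕ) : (Fin (m + 1) → ℝ) →L[ℝ] (Fin m → ℝ) :=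
  ContinuousLinearMap.pi fun i => ContinuousLinearMap.proj (Fin.castSucc i)

lemma projL_apply (x : Fin (m + 1) → ℝ) : projL m x = proj x := rfl

lemma projL_cs (i : Fin m) : projL m (Pi.single (Fin.castSucc i) 1) = Pi.single i 1 := by
  ext j
  simp [projL, Pi.single_apply]

lemma projL_last : projL m (Pi.single (Fin.last m) 1) = 0 := by
  ext j
  simp [projL, Pi.single_apply]

lemma hasF_comp (v : (Fin m → ℝ) → ℝ) (x : Fin (m + 1) → ℝ)
    (hv : DifferentiableAt ℝ v (proj x)) :
    HasFDerivAt (fun y => v (proj y)) ((fderiv ℝ v (proj x)).comp (projL m)) x := by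
  have h1 : HasFDerivAt v (fderiv ℝ v (proj x)) (projL m x) := hv.hasFDerivAt
  exact h1.comp x (projL m).hasFDerivAt

lemma pd_comp_cs (v : (Fin m → ℝ) → ℝ) (x : Fin (m + 1) → ℝ)
    (hv : DifferentiableAt ℝ v (proj x)) (i : Fin m) :
    pd (Fin.castSucc i) (fun y => v (proj y)) x = pd i v (proj x) := by
  unfold pd
  rw [(hasF_comp v x hv).fderiv]
  simp [projL_cs]

lemma pd_comp_last (v : (Fin m → ℝ) → ℝ) (x : Fin (m + 1) → ℝ)
    (hv : DifferentiableAt ℝ v (proj x)) :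
    pd (Fin.last m) (fun y => v (proj y)) x = 0 := by
  unfold pd
  rw [(hasF_comp v x hv).fderiv]
  simp [projL_last]

lemma pd_mul {k : ℕ} (i : Fin k) (f g : (Fin k → ℝ) → ℝ) (x : Fin k → ℝ)
    (hf : DifferentiableAt ℝ f x) (hg : DifferentiableAt ℝ g x) :
    pd i (fun y => f y * g y) x = pd i f x * g x + f x * pd i g x := by
  unfold pd
  rw [fderiv_fun_mul hf hg]
  simp
  ring

lemma pd_zero {k : ℕ} (i : Fin k) (x : Fin k → ℝ) :
    pd i (fun _ : Fin k → ℝ => (0 : ℝ)) x = 0 := by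
  simp [pd]

lemma hasF_f (u : (Fin m → ℝ) → ℝ) (x : Fin (m + 1) → ℝ)
    (hv : DifferentiableAt ℝ u (proj x)) :
    HasFDerivAt (fun y : Fin (m + 1) → ℝ => y (Fin.last m) - ext u y)
      (ContinuousLinearMap.proj (R := ℝ) (φ := fun _ : Fin (m + 1) => ℝ) (Fin.last m)
        - (fderiv ℝ u (proj x)).comp (projL m)) x :=
  (ContinuousLinearMap.proj (R := ℝ) (φ := fun _ : Fin (m + 1) => ℝ)
    (Fin.last m)).hasFDerivAt.sub (hasF_comp u x hv)

lemma pd_f_cs (u : (Fin m → ℝ) → ℝ) (x : Fin (m + 1) → ℝ)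
    (hv : DifferentiableAt ℝ u (proj x)) (i : Fin m) :
    pd (Fin.castSucc i) (fun y : Fin (m + 1) → ℝ => y (Fin.last m) - ext u y) x
      = - pd i u (proj x) := by
  unfold pd
  rw [(hasF_f u x hv).fderiv]
  simp [projL_cs, Pi.single_apply]

lemma pd_f_last (u : (Fin m → ℝ) → ℝ) (x : Fin (m + 1) → ℝ)
    (hv : DifferentiableAt ℝ u (proj x)) :
    pd (Fin.last m) (fun y : Fin (m + 1) → ℝ => y (Fin.last m) - ext u y) x = 1 := by
  unfold pd
  rw [(hasF_f u x hv).fderiv]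
  simp [projL_last, Pi.single_apply]

lemma pd_u_diff (u : (Fin m → ℝ) → ℝ) (hu : ContDiff ℝ 2 u) (j : Fin m) :
    Differentiable ℝ (pd j u) := by
  have h : ContDiff ℝ 1 (fderiv ℝ u) := hu.fderiv_right (by norm_num)
  have h2 : Differentiable ℝ (fderiv ℝ u) := h.differentiable (by norm_num)
  exact h2.clm_apply (differentiable_const _)

lemma pdd_cs (u : (Fin m → ℝ) → ℝ) (hu : ContDiff ℝ 2 u) (x : Fin (m + 1) → ℝ) (i j : Fin m) :
    pd (Fin.castSucc i) (pd (Fin.castSucc j)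
      (fun y : Fin (m + 1) → ℝ => y (Fin.last m) - ext u y)) x = - pd i (pd j u) (proj x) := by
  have hd : Differentiable ℝ u := hu.differentiable (by norm_num)
  have h : pd (Fin.castSucc j) (fun y : Fin (m + 1) → ℝ => y (Fin.last m) - ext u y)
      = fun y => (fun z => - pd j u z) (proj y) := by
    funext y; exact pd_f_cs u y (hd _) j
  rw [h, pd_comp_cs (fun z => - pd j u z) x ((pd_u_diff u hu j).neg _)]
  unfold pd
  rw [fderiv_fun_neg]
  simp

lemma pdd_last (u : (Fin m → ℝ) → ℝ) (hu : ContDiff ℝ 2 u) (x : Fin (m + 1) → ℝ)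
    (i : Fin (m + 1)) :
    pd i (pd (Fin.last m)
      (fun y : Fin (m + 1) → ℝ => y (Fin.last m) - ext u y)) x = 0 := by
  have hd : Differentiable ℝ u := hu.differentiable (by norm_num)
  have h : pd (Fin.last m) (fun y : Fin (m + 1) → ℝ => y (Fin.last m) - ext u y)
      = fun y => 1 := by
    funext y; exact pd_f_last u y (hd _)
  rw [h]
  simp [pd]

section met
variable (c : (Fin (m + 1) → ℝ) → ℝ) (ghat : (Fin m → ℝ) → Matrix (Fin m) (Fin m) ℝ)
  (x : Fin (m + 1) → ℝ)

lemma gMet_cc (i j : Fin m) :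
    gMet c ghat x i.castSucc j.castSucc = c x * ghat (proj x) i j := by
  simp [gMet]

lemma gMet_cl (i : Fin m) : gMet c ghat x i.castSucc (Fin.last m) = 0 := by
  simp [gMet]

lemma gMet_lc (i : Fin m) : gMet c ghat x (Fin.last m) i.castSucc = 0 := by
  simp [gMet]

lemma gMet_ll : gMet c ghat x (Fin.last m) (Fin.last m) = c x := by
  simp [gMet]

lemma gMet_inv (hc : c x ≠ 0) (hd : IsUnit (ghat (proj x)).det) :
    (gMet c ghat x)⁻¹ = gMet (fun y => (c y)⁻¹) (fun y => (ghat y)⁻¹) x := by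
  apply Matrix.inv_eq_right_inv
  have h := Matrix.mul_nonsing_inv _ hd
  ext i j
  rw [Matrix.mul_apply, Fin.sum_univ_castSucc]
  refine Fin.lastCases ?_ (fun i => ?_) i <;> refine Fin.lastCases ?_ (fun j => ?_) j
  · simp [gMet_cc, gMet_cl, gMet_lc, gMet_ll, hc]
  · simp [gMet_cc, gMet_cl, gMet_lc, gMet_ll, Matrix.one_apply, Fin.ext_iff, j.2.ne']
  · simp [gMet_cc, gMet_cl, gMet_lc, gMet_ll, Matrix.one_apply, Fin.ext_iff, i.2.ne]
  · have h2 := congrFun (congrFun h i) j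
    rw [Matrix.mul_apply] at h2
    simp only [gMet_cc, gMet_cl, gMet_lc]
    rw [Matrix.one_apply] at h2 ⊢
    simp only [Fin.castSucc_inj]
    rw [← h2, mul_zero, add_zero]
    refine Finset.sum_congr rfl fun l _ => ?_
    field_simp

end met

section chr
variable (c : (Fin (m + 1) → ℝ) → ℝ) (ghat : (Fin m → ℝ) → Matrix (Fin m) (Fin m) ℝ)
  (x : Fin (m + 1) → ℝ)

lemma pdg_c (hc : DifferentiableAt ℝ c x)
    (hg : ∀ i j, DifferentiableAt ℝ (fun y => ghat y i j) (proj x)) (i a b : Fin m) :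
    pd i.castSucc (fun y => gMet c ghat y a.castSucc b.castSucc) x
      = pd i.castSucc c x * ghat (proj x) a b + c x * pd i (fun y => ghat y a b) (proj x) := by
  simp only [gMet_cc]
  rw [pd_mul _ _ _ _ hc (hasF_comp _ x (hg a b)).differentiableAt,
    pd_comp_cs (fun y => ghat y a b) x (hg a b)]

lemma pdg_l (hc : DifferentiableAt ℝ c x)
    (hg : ∀ i j, DifferentiableAt ℝ (fun y => ghat y i j) (proj x)) (a b : Fin m) :
    pd (Fin.last m) (fun y => gMet c ghat y a.castSucc b.castSucc) x
      = pd (Fin.last m) c x * ghat (proj x) a b := by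
  simp only [gMet_cc]
  rw [pd_mul _ _ _ _ hc (hasF_comp _ x (hg a b)).differentiableAt,
    pd_comp_last (fun y => ghat y a b) x (hg a b)]
  ring

variable (hcd : DifferentiableAt ℝ c x)
    (hg : ∀ i j, DifferentiableAt ℝ (fun y => ghat y i j) (proj x))
    (hc : c x ≠ 0) (hd : IsUnit (ghat (proj x)).det)
include hcd hg hc hd

lemma chr_ccc (a i j : Fin m) :
    christoffel (gMet c ghat) a.castSucc i.castSucc j.castSucc x
      = christoffel ghat a i j (proj x) + 1 / (2 * c x) *
        (∑ l, (ghat (proj x))⁻¹ a l * (pd i.castSucc c x * ghat (proj x) j l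
          + pd j.castSucc c x * ghat (proj x) i l - pd l.castSucc c x * ghat (proj x) i j)) := by
  unfold christoffel
  rw [gMet_inv c ghat x hc hd, Fin.sum_univ_castSucc]
  simp only [pdg_c c ghat x hcd hg]
  simp only [gMet_cc, gMet_cl, zero_mul, add_zero, Finset.mul_sum, ← Finset.sum_add_distrib]
  refine Finset.sum_congr rfl fun l _ => ?_
  field_simp
  ring

lemma chr_lcc (i j : Fin m) :
    christoffel (gMet c ghat) (Fin.last m) i.castSucc j.castSucc x
      = - (1 / (2 * c x) * (pd (Fin.last m) c x * ghat (proj x) i j)) := by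
  unfold christoffel
  rw [gMet_inv c ghat x hc hd, Fin.sum_univ_castSucc]
  rw [pdg_l c ghat x hcd hg]
  simp only [gMet_cl, gMet_lc, gMet_ll, pd_zero]
  simp
  ring

lemma chr_cll (a : Fin m) :
    christoffel (gMet c ghat) a.castSucc (Fin.last m) (Fin.last m) x
      = - (1 / (2 * c x) * ∑ l, (ghat (proj x))⁻¹ a l * pd l.castSucc c x) := by
  unfold christoffel
  rw [gMet_inv c ghat x hc hd, Fin.sum_univ_castSucc]
  simp only [gMet_cl, gMet_lc, gMet_ll, pd_zero, gMet_cc]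
  simp only [Finset.mul_sum, zero_mul, add_zero, ← Finset.sum_neg_distrib]
  refine Finset.sum_congr rfl fun l _ => ?_
  field_simp
  ring

lemma chr_lll :
    christoffel (gMet c ghat) (Fin.last m) (Fin.last m) (Fin.last m) x
      = 1 / (2 * c x) * pd (Fin.last m) c x := by
  unfold christoffel
  rw [gMet_inv c ghat x hc hd, Fin.sum_univ_castSucc]
  simp only [gMet_cl, gMet_lc, gMet_ll, pd_zero, gMet_cc]
  simp
  field_simp

end chr

lemma alg (G g : Matrix (Fin m) (Fin m) ℝ) (hGg : G * g = 1) (hg : g.transpose = g) (hG : G.transpose = G)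
    (p v : Fin m → ℝ) :
    ∑ i, ∑ j, G i j * ∑ a, (∑ l, G a l * (p i * g j l + p j * g i l - p l * g i j)) * v a
      = (2 - (m : ℝ)) * ∑ a, ∑ l, G a l * p l * v a := by
  have e (a j : Fin m) : ∑ l, G a l * g j l = (1 : Matrix (Fin m) (Fin m) ℝ) a j := by
    rw [← hGg, Matrix.mul_apply]
    refine Finset.sum_congr rfl fun l _ => ?_
    rw [← congrFun (congrFun hg l) j, Matrix.transpose_apply]
  have s (i j) : G i j = G j i := (congrFun (congrFun hG i) j).symm
  have h1 (i j a : Fin m) : (∑ l, G a l * (p i * g j l + p j * g i l - p l * g i j))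
      = p i * (1 : Matrix (Fin m) (Fin m) ℝ) a j + p j * (1 : Matrix (Fin m) (Fin m) ℝ) a i
        - g i j * ∑ l, G a l * p l := by
    rw [← e, ← e, Finset.mul_sum, Finset.mul_sum, Finset.mul_sum, ← Finset.sum_add_distrib,
      ← Finset.sum_sub_distrib]
    refine Finset.sum_congr rfl fun l _ => ?_
    ring
  have tr : ∑ i, ∑ j, G i j * g i j = (m : ℝ) := by
    simp [e]
  simp only [h1]
  have h2 (i j : Fin m) : G i j * ∑ a, (p i * (1 : Matrix (Fin m) (Fin m) ℝ) a j
      + p j * (1 : Matrix (Fin m) (Fin m) ℝ) a i - g i j * ∑ l, G a l * p l) * v a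
      = G j i * p i * v j + G i j * p j * v i
        - (G i j * g i j) * ∑ a, ∑ l, G a l * p l * v a := by
    simp only [sub_mul, add_mul, Finset.sum_sub_distrib, Finset.sum_add_distrib,
      Matrix.one_apply, mul_ite, ite_mul, mul_one, mul_zero, zero_mul, Finset.sum_ite_eq',
      Finset.mem_univ, if_true]
    rw [s j i]
    simp only [← Finset.sum_mul, mul_assoc, ← Finset.mul_sum]
    ring_nf
    simp only [Finset.sum_mul]
  simp only [h2, Finset.sum_sub_distrib, Finset.sum_add_distrib]
  simp only [← Finset.sum_mul]
  rw [tr, Finset.sum_comm]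
  simp only [← Finset.sum_mul]
  ring

end helpers

/-- For `f(x', x_n) = x_n − u(x')` one has
`c² |∇_g f|²_g Δ_g f = (1 + |∇_ĝ u|²_ĝ)(−Δ_ĝ u + ((2−n)/(2c)) ĝ^{mr} ∂_r c ∂_m u
  − ((2−n)/(2c)) ∂_n c)`, where `n = m+1`. -/
theorem gradSq_mul_laplaceB_graph (m : ℕ) (hm : 2 ≤ m)
    (ghat : (Fin m → ℝ) → Matrix (Fin m) (Fin m) ℝ)
    (hghat : ∀ i j, ContDiff ℝ (⊤ : ℕ∞) fun x' => ghat x' i j)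
    (hpd : ∀ x', (ghat x').PosDef)
    (c : (Fin (m + 1) → ℝ) → ℝ)
    (hc : ContDiff ℝ (⊤ : ℕ∞) c) (hcpos : ∀ x, 0 < c x)
    (u : (Fin m → ℝ) → ℝ) (hu : ContDiff ℝ 2 u)
    (x : Fin (m + 1) → ℝ) :
    c x ^ 2 * (gradSq (gMet c ghat) (fun y => y (Fin.last m) - ext u y) x
        * laplaceB (gMet c ghat) (fun y => y (Fin.last m) - ext u y) x)
      = (1 + gradSq ghat u (proj x)) *
          (-(laplaceB ghat u (proj x))
            + ((2 - ((m : ℝ) + 1)) / (2 * c x)) *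
                ∑ mm : Fin m, ∑ r : Fin m,
                  (ghat (proj x))⁻¹ mm r * pd (Fin.castSucc r) c x * pd mm u (proj x)
            - ((2 - ((m : ℝ) + 1)) / (2 * c x)) * pd (Fin.last m) c x) := by
  have hdu : Differentiable ℝ u := hu.differentiable (by norm_num)
  have hc0 : c x ≠ 0 := (hcpos x).ne'
  have hdet : IsUnit (ghat (proj x)).det := (hpd (proj x)).det_pos.ne'.isUnit
  have hcd : DifferentiableAt ℝ c x := hc.differentiable (by simp) x
  have hgd : ∀ i j, DifferentiableAt ℝ (fun y => ghat y i j) (proj x) :=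
    fun i j => (hghat i j).differentiable (by simp) _
  have hsym : (ghat (proj x)).transpose = ghat (proj x) := by
    have := (hpd (proj x)).1
    rwa [Matrix.IsHermitian, Matrix.conjTranspose_eq_transpose_of_trivial] at this
  have hGsym : ((ghat (proj x))⁻¹).transpose = (ghat (proj x))⁻¹ := by
    rw [Matrix.transpose_nonsing_inv, hsym]
  have hGg := Matrix.nonsing_inv_mul _ hdet
  have hGg' := Matrix.mul_nonsing_inv _ hdet
  have A : c x * gradSq (gMet c ghat) (fun y => y (Fin.last m) - ext u y) x
      = 1 + gradSq ghat u (proj x) := by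
    unfold gradSq
    rw [gMet_inv c ghat x hc0 hdet]
    simp only [Fin.sum_univ_castSucc, pd_f_cs u x (hdu _), pd_f_last u x (hdu _),
      gMet_cc, gMet_cl, gMet_lc, gMet_ll]
    simp only [zero_mul, Finset.sum_const_zero, add_zero, zero_add, mul_add, mul_one]
    rw [mul_inv_cancel₀ hc0, add_comm]
    congr 1
    simp only [Finset.mul_sum]
    refine Finset.sum_congr rfl fun i _ => Finset.sum_congr rfl fun j _ => ?_
    field_simp
  have B : c x * laplaceB (gMet c ghat) (fun y => y (Fin.last m) - ext u y) x
      = (-(laplaceB ghat u (proj x))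
            + ((2 - ((m : ℝ) + 1)) / (2 * c x)) *
                ∑ mm : Fin m, ∑ r : Fin m,
                  (ghat (proj x))⁻¹ mm r * pd (Fin.castSucc r) c x * pd mm u (proj x)
            - ((2 - ((m : ℝ) + 1)) / (2 * c x)) * pd (Fin.last m) c x) := by
    have key := alg _ _ hGg hsym hGsym (fun i => pd i.castSucc c x) (fun i => pd i u (proj x))
    have tr : ∑ i, ∑ j, (ghat (proj x))⁻¹ i j * ghat (proj x) i j = (m : ℝ) := by
      have : ∀ i, ∑ j, (ghat (proj x))⁻¹ i j * ghat (proj x) i j = 1 := by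
        intro i
        have h := congrFun (congrFun hGg i) i
        rw [Matrix.mul_apply, Matrix.one_apply_eq] at h
        rw [← h]
        refine Finset.sum_congr rfl fun l _ => ?_
        rw [← congrFun (congrFun hsym l) i, Matrix.transpose_apply]
      simp [this]
    unfold laplaceB
    rw [gMet_inv c ghat x hc0 hdet]
    simp only [Fin.sum_univ_castSucc, pd_f_cs u x (hdu _), pd_f_last u x (hdu _),
      gMet_cc, gMet_cl, gMet_lc, gMet_ll, pdd_cs u hu, pdd_last u hu,
      chr_ccc c ghat x hcd hgd hc0 hdet, chr_lcc c ghat x hcd hgd hc0 hdet,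
      chr_cll c ghat x hcd hgd hc0 hdet, chr_lll c ghat x hcd hgd hc0 hdet]
    simp only [zero_mul, Finset.sum_const_zero, add_zero, zero_add, mul_one]
    set G := (ghat (proj x))⁻¹ with hGdef
    set S := ∑ mm : Fin m, ∑ r : Fin m, G mm r * pd (Fin.castSucc r) c x * pd mm u (proj x)
      with hS
    have e1 : ∑ a : Fin m, -(1 / (2 * c x) * ∑ l, G a l * pd l.castSucc c x)
        * -pd a u (proj x) = 1 / (2 * c x) * S := by
      rw [hS, Finset.mul_sum]
      refine Finset.sum_congr rfl fun a _ => ?_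
      rw [neg_mul_neg, mul_assoc, Finset.sum_mul]
    rw [e1]
    have e2 (i j : Fin m) : (c x)⁻¹ * G i j * (-pd i (pd j u) (proj x) -
        (∑ a : Fin m, (christoffel ghat a i j (proj x) + 1 / (2 * c x) *
        (∑ l, G a l * (pd i.castSucc c x * ghat (proj x) j l
          + pd j.castSucc c x * ghat (proj x) i l - pd l.castSucc c x * ghat (proj x) i j)))
          * -pd a u (proj x)
          + -(1 / (2 * c x) * (pd (Fin.last m) c x * ghat (proj x) i j))))
        = (c x)⁻¹ * (-(G i j * (pd i (pd j u) (proj x)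
            - ∑ a : Fin m, christoffel ghat a i j (proj x) * pd a u (proj x)))
          + 1 / (2 * c x) * (G i j * ∑ a, (∑ l, G a l * (pd i.castSucc c x * ghat (proj x) j l
          + pd j.castSucc c x * ghat (proj x) i l - pd l.castSucc c x * ghat (proj x) i j))
            * pd a u (proj x))
          + 1 / (2 * c x) * pd (Fin.last m) c x * (G i j * ghat (proj x) i j)) := by
      simp only [add_mul, mul_neg, Finset.sum_add_distrib, Finset.sum_neg_distrib, mul_assoc,
        ← Finset.mul_sum]
      ring
    simp only [e2, ← Finset.mul_sum, Finset.sum_add_distrib, Finset.sum_neg_distrib]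
    rw [key, tr]
    field_simp
    ring
  rw [← A, ← B]
  ring
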